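/- arXiv:2602.17344 — 2 statements merged into one kernel-verified Lean document; each statement's English description precedes it below -/
import Mathlib

section
/- Let d ≥ 2. The set Y2 ∩ {x ∈ ℝ^d : ‖x‖ < 2k0} \ ℝν is open in ℝ^d and dense in Y2 (i.e., Y2 is contained in its closure). -/
open Set MeasureTheory
open scoped RealInnerProductSpace

noncomputable section

abbrev Euc (d : ℕ) := EuclideanSpace ℝ (Fin d)

/-- Reflection across the hyperplane `ν^⊥` (Householder transform). -/
def Hr {d : ℕ} (ν x : Euc d) : Euc d := x - (2 * ⟪x, ν⟫) • ν

/-- Open hemisphere of radius `k0` in direction `v`. -/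
def Shemi {d : ℕ} (k0 : ℝ) (v : Euc d) : Set (Euc d) := {x | ‖x‖ = k0 ∧ 0 < ⟪x, v⟫}

def Sig1 {d : ℕ} (k0 : ℝ) (ν ω : Euc d) : Set (Euc d) :=
  {σ | σ ∈ Shemi k0 ω ∧ Hr ν σ ∉ Shemi k0 ω}

def Sig2 {d : ℕ} (k0 : ℝ) (ν ω : Euc d) : Set (Euc d) :=
  {σ | σ ∈ Shemi k0 ω ∧ Hr ν σ ∈ Shemi k0 ω}

def Y1set {d : ℕ} (k0 : ℝ) (ν ω e : Euc d) : Set (Euc d) :=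
  {y | ∃ η ∈ Shemi k0 e, ∃ σ ∈ Sig1 k0 ν ω, y = η - σ}

def Y2set {d : ℕ} (k0 : ℝ) (ν ω e : Euc d) : Set (Euc d) :=
  {y | ∃ η ∈ Shemi k0 e, ∃ σ ∈ Sig2 k0 ν ω, y = η - σ}

def Sig2chi {d : ℕ} (k0 χ : ℝ) (ν ω : Euc d) : Set (Euc d) :=
  {x | ∃ σ ∈ Sig2 k0 ν ω, ∃ t ∈ Set.Ioo (1 - χ) (1 + χ), x = t • σ}

/-- The hypotheses on the coefficient function `b`. -/
def BHyp {d : ℕ} (k0 χ : ℝ) (ν ω : Euc d) (b : Euc d → ℂ) : Prop :=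
  (∀ x ∈ Sig2chi k0 χ ν ω, b x ≠ 0) ∧
  ∀ σ ∈ Sig2 k0 ν ω, ∀ t ∈ Set.Ioo (1 - χ) (1 + χ), b (t • σ) = b σ

/-- `g` solves the homogeneous system. -/
def SolvesHom {d : ℕ} (k0 : ℝ) (ν ω e : Euc d) (b g : Euc d → ℂ) : Prop :=
  ∀ η ∈ Shemi k0 e,
    (∀ σ ∈ Sig1 k0 ν ω, g (η - σ) = 0) ∧
    ∀ σ ∈ Sig2 k0 ν ω, b σ * g (η - σ) + g (η - Hr ν σ) = 0

/-- The coupling set `F_y`. -/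
def Fcoup {d : ℕ} (k0 : ℝ) (ν ω e : Euc d) (y : Euc d) : Set (Euc d) :=
  {z | ∃ η ∈ Shemi k0 e, ∃ σ ∈ Sig2 k0 ν ω, y = η - σ ∧ z = η - Hr ν σ}

/-- The set `C_{y,λ}`. -/
def Cset {d : ℕ} (k0 : ℝ) (ν ω e : Euc d) (y : Euc d) (lam : ℝ) : Set (Euc d) :=
  {σ | σ ∈ Sig2 k0 ν ω ∧ σ + y ∈ Shemi k0 e ∧ ⟪σ, ν⟫ = lam}

/-- The `d`-th standard basis vector. -/
def eLast (d : ℕ) (hd : 0 < d) : Euc d :=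
  EuclideanSpace.single ⟨d - 1, Nat.sub_lt hd one_pos⟩ 1

def e2 : Euc 2 := EuclideanSpace.single 1 1
def e3 : Euc 3 := EuclideanSpace.single 2 1

/-- Degenerate points. -/
def degS {d : ℕ} (k0 : ℝ) (ν ω e : Euc d) : Set (Euc d) :=
  {y | ∃ η ∈ Shemi k0 e, ∃ σ ∈ Sig2 k0 ν ω, (⟪η, ν⟫ = 0 ∨ ⟪σ, ν⟫ = 0) ∧ y = η - σ}

/-- Non-degenerate points `Y2'`. -/
def Y2nd {d : ℕ} (k0 : ℝ) (ν ω e : Euc d) : Set (Euc d) :=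
  (Y2set k0 ν ω e ∩ {x | ‖x‖ < 2 * k0}) \
    (degS k0 ν ω e ∪ {x | ⟪x, ν⟫ = 0} ∪ {x | ∃ t : ℝ, x = t • ν})

/-- The set `Ỹ`. -/
def Ytil {d : ℕ} (k0 : ℝ) (ν ω e : Euc d) : Set (Euc d) :=
  {y | ∃ η ∈ Shemi k0 e, -η ∈ Sig1 k0 ν ω ∧
    ∃ σ ∈ Sig2 k0 ν ω, σ ∈ Shemi k0 (-e) ∧ Hr ν σ ∉ Shemi k0 (-e) ∧ y = η - Hr ν σ}

/-- Cross product on `Euc 3`. -/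
def cross3 (a b : Euc 3) : Euc 3 :=
  (EuclideanSpace.equiv (Fin 3) ℝ).symm
    ![a 1 * b 2 - a 2 * b 1, a 2 * b 0 - a 0 * b 2, a 0 * b 1 - a 1 * b 0]

end

open scoped Topology

section SphereDifferences

variable {E : Type*} [NormedAddCommGroup E] [InnerProductSpace ℝ E]

/-- Near `η - σ`, for `η ≠ ± σ` on a sphere, every vector is a difference of two points of the
sphere which depend continuously on the vector. -/
lemma exists_continuousAt_sub_of_norm_eq {r : ℝ} {η σ : E} (hη : ‖η‖ = r) (hσ : ‖σ‖ = r)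
    (hne : η - σ ≠ 0) (hne' : η + σ ≠ 0) :
    ∃ f g : E → E, ContinuousAt f (η - σ) ∧ ContinuousAt g (η - σ) ∧
      f (η - σ) = η ∧ g (η - σ) = σ ∧
      ∀ᶠ y in 𝓝 (η - σ), ‖f y‖ = r ∧ ‖g y‖ = r ∧ y = f y - g y := by
  set y₀ := η - σ with hy₀
  have horth : ⟪η + σ, y₀⟫ = 0 := by
    simp only [hy₀, inner_add_left, inner_sub_right, real_inner_self_eq_norm_sq, hη, hσ,
      real_inner_comm η σ]
    ring
  have hpar : ‖η + σ‖ ^ 2 = 4 * (r ^ 2 - ‖y₀‖ ^ 2 / 4) := by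
    have := parallelogram_law_with_norm ℝ η σ
    rw [hη, hσ] at this
    linarith
  have hpos : 0 < ‖η + σ‖ := norm_pos_iff.2 hne'
  let p : E → E := fun y ↦ (η + σ) - (⟪η + σ, y⟫ / ‖y‖ ^ 2) • y
  let m : E → E := fun y ↦ (Real.sqrt (r ^ 2 - ‖y‖ ^ 2 / 4) / ‖p y‖) • p y
  have hp₀ : p y₀ = η + σ := by simp [p, horth]
  have hnorm₀ : ‖y₀‖ ^ 2 ≠ 0 := by simpa using hne
  have hpc : ContinuousAt p y₀ := by
    refine continuousAt_const.sub (ContinuousAt.smul ?_ continuousAt_id)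
    exact ContinuousAt.div (by fun_prop) (by fun_prop) hnorm₀
  have hp₀' : ‖p y₀‖ ≠ 0 := by rw [hp₀]; exact hpos.ne'
  have hmc : ContinuousAt m y₀ := by
    refine ContinuousAt.smul (ContinuousAt.div ?_ hpc.norm hp₀') hpc
    exact Continuous.continuousAt (by fun_prop)
  have hsqrt : Real.sqrt (r ^ 2 - ‖y₀‖ ^ 2 / 4) = ‖η + σ‖ / 2 := by
    rw [Real.sqrt_eq_iff_mul_self_eq_of_pos (by positivity)]
    linarith
  have hm₀ : m y₀ = (1 / 2 : ℝ) • (η + σ) := by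
    simp only [m, hp₀, hsqrt]
    congr 1
    field_simp
  refine ⟨fun y ↦ m y + (1 / 2 : ℝ) • y, fun y ↦ m y - (1 / 2 : ℝ) • y,
    hmc.add (by fun_prop), hmc.sub (by fun_prop), ?_, ?_, ?_⟩
  · beta_reduce
    rw [hm₀, hy₀]
    module
  · beta_reduce
    rw [hm₀, hy₀]
    module
  have hy : ∀ᶠ y in 𝓝 y₀, ‖y‖ ^ 2 ≠ 0 :=
    ContinuousAt.eventually_ne (g := fun y : E ↦ ‖y‖ ^ 2) (by fun_prop) hnorm₀
  have hlt : ∀ᶠ y in 𝓝 y₀, 0 < r ^ 2 - ‖y‖ ^ 2 / 4 :=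
    ContinuousAt.eventually_lt (f := fun _ : E ↦ (0 : ℝ)) (g := fun y : E ↦ r ^ 2 - ‖y‖ ^ 2 / 4)
      (by fun_prop) (by fun_prop) (by nlinarith)
  filter_upwards [hy, hlt, hpc.norm.eventually_ne hp₀'] with y hy hlt hpy
  have hr : 0 ≤ r := hη ▸ norm_nonneg η
  have horth' : ⟪m y, y⟫ = 0 := by
    simp only [m, p, inner_smul_left, inner_sub_left, real_inner_self_eq_norm_sq]
    rw [RCLike.conj_to_real, RCLike.conj_to_real, div_mul_cancel₀ _ hy, sub_self, mul_zero]
  have hmn : ‖m y‖ ^ 2 = r ^ 2 - ‖y‖ ^ 2 / 4 := by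
    simp only [m]
    rw [norm_smul, norm_div, norm_norm, div_mul_cancel₀ _ hpy, Real.norm_eq_abs, sq_abs,
      Real.sq_sqrt hlt.le]
  refine ⟨?_, ?_, by module⟩
  · rw [← sq_eq_sq₀ (norm_nonneg _) hr, norm_add_sq_real, hmn, inner_smul_right, horth',
      norm_smul, mul_pow]
    norm_num
    ring
  · rw [← sq_eq_sq₀ (norm_nonneg _) hr, norm_sub_sq_real, hmn, inner_smul_right, horth',
      norm_smul, mul_pow]
    norm_num
    ring

lemma preperfect_sphere (h : 1 < Module.rank ℝ E) {r : ℝ} (hr : 0 < r) :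
    Preperfect (Metric.sphere (0 : E) r) := by
  have : Nontrivial E := rank_pos_iff_nontrivial.1 (zero_lt_one.trans h)
  refine (isPreconnected_sphere h 0 r).preperfect_of_nontrivial ?_
  obtain ⟨x, hx⟩ := NormedSpace.sphere_nonempty (E := E) (x := 0) |>.2 hr.le
  refine ⟨x, hx, -x, by simpa using hx, fun hxx ↦ ?_⟩
  have : x = 0 := by linear_combination (norm := module) (1 / 2 : ℝ) • hxx
  simp [this, hr.ne] at hx

end SphereDifferences

section Hemispheres

variable {d : ℕ}

lemma norm_Hr {ν : Euc d} (hν : ‖ν‖ = 1) (x : Euc d) : ‖Hr ν x‖ = ‖x‖ := by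
  rw [← sq_eq_sq₀ (norm_nonneg _) (norm_nonneg _), Hr, norm_sub_sq_real, inner_smul_right,
    norm_smul, mul_pow, hν, Real.norm_eq_abs, sq_abs]
  ring

lemma continuous_Hr (ν : Euc d) : Continuous (Hr ν) := by
  unfold Hr
  fun_prop

lemma mem_Sig2_iff {k0 : ℝ} {ν ω σ : Euc d} (hν : ‖ν‖ = 1) :
    σ ∈ Sig2 k0 ν ω ↔ ‖σ‖ = k0 ∧ 0 < ⟪σ, ω⟫ ∧ 0 < ⟪Hr ν σ, ω⟫ := by
  simp only [Sig2, Shemi, mem_ofPred_eq, norm_Hr hν]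
  tauto

/-- A line in direction `ν` through a point `σ` of a sphere centred at the origin meets the sphere
only in `σ` and in its reflection. -/
lemma eq_or_eq_Hr_of_sub_eq_smul {ν η σ : Euc d} (hν : ‖ν‖ = 1) (h : ‖η‖ = ‖σ‖) {t : ℝ}
    (ht : η - σ = t • ν) : η = σ ∨ η = Hr ν σ := by
  obtain rfl : η = σ + t • ν := by rw [← ht]; abel
  have h2 : ‖σ + t • ν‖ ^ 2 = ‖σ‖ ^ 2 := by rw [h]
  rw [norm_add_sq_real, inner_smul_right, norm_smul, mul_pow, hν, Real.norm_eq_abs, sq_abs] at h2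
  have h3 : t * (t + 2 * ⟪σ, ν⟫) = 0 := by linarith
  rcases mul_eq_zero.1 h3 with h0 | h0
  · left; simp [h0]
  · right
    rw [eq_neg_of_add_eq_zero_left h0, Hr]
    module

lemma Y2set_mem_nhds {k0 : ℝ} {ν ω e y : Euc d} (hν : ‖ν‖ = 1) (hy : y ∈ Y2set k0 ν ω e)
    (hy0 : y ≠ 0) (hlt : ‖y‖ < 2 * k0) : Y2set k0 ν ω e ∈ 𝓝 y := by
  obtain ⟨η, ⟨hη, hηe⟩, σ, hσ, rfl⟩ := hy
  obtain ⟨hσn, hσω, hσω'⟩ := (mem_Sig2_iff hν).1 hσ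
  have hne : η + σ ≠ 0 := fun h0 ↦ by
    rw [eq_neg_of_add_eq_zero_left h0, ← neg_add', norm_neg, ← two_smul ℝ σ, norm_smul, hσn] at hlt
    simp at hlt
  obtain ⟨f, g, hf, hg, hf₀, hg₀, hfg⟩ := exists_continuousAt_sub_of_norm_eq hη hσn hy0 hne
  have h₁ : ∀ᶠ y in 𝓝 (η - σ), 0 < ⟪f y, e⟫ :=
    continuousAt_const.eventually_lt (hf.inner continuousAt_const) (by rwa [hf₀])
  have h₂ : ∀ᶠ y in 𝓝 (η - σ), 0 < ⟪g y, ω⟫ :=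
    continuousAt_const.eventually_lt (hg.inner continuousAt_const) (by rwa [hg₀])
  have h₃ : ∀ᶠ y in 𝓝 (η - σ), 0 < ⟪Hr ν (g y), ω⟫ :=
    continuousAt_const.eventually_lt
      (((continuous_Hr ν).continuousAt.comp hg).inner continuousAt_const)
      (by simpa only [Function.comp, hg₀] using hσω')
  filter_upwards [hfg, h₁, h₂, h₃] with y ⟨hfy, hgy, hy⟩ h₁ h₂ h₃
  exact ⟨f y, ⟨hfy, h₁⟩, g y, (mem_Sig2_iff hν).2 ⟨hgy, h₂, h₃⟩, hy⟩

lemma isClosed_setOf_eq_smul (ν : Euc d) : IsClosed {x : Euc d | ∃ t : ℝ, x = t • ν} := by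
  convert (Submodule.span ℝ {ν}).closed_of_finiteDimensional using 1
  ext x
  simp [Submodule.mem_span_singleton, eq_comm]

lemma norm_sub_lt_two_mul {k0 : ℝ} (hk0 : 0 < k0) {η σ : Euc d} (hη : ‖η‖ = k0) (hσ : ‖σ‖ = k0)
    (hne : η ≠ -σ) : ‖η - σ‖ < 2 * k0 := by
  have hpos : 0 < ‖η + σ‖ := norm_pos_iff.2 fun h ↦ hne (eq_neg_of_add_eq_zero_left h)
  have := parallelogram_law_with_norm ℝ η σ
  rw [hη, hσ] at this
  exact lt_of_pow_lt_pow_left₀ 2 (by positivity) (by nlinarith)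

end Hemispheres

/-- `Y2 ∩ B_{2k0} \ ℝν` is open and dense in `Y2`. -/
theorem stmt7 {d : ℕ} (hd : 2 ≤ d) (k0 : ℝ) (hk0 : 0 < k0)
    (ν ω : Euc d) (hν : ‖ν‖ = 1) (hω : ‖ω‖ = 1)
    (e : Euc d) (he : e = eLast d (by omega)) :
    IsOpen ((Y2set k0 ν ω e ∩ {x | ‖x‖ < 2 * k0}) \ {x | ∃ t : ℝ, x = t • ν}) ∧
    Y2set k0 ν ω e ⊆
      closure ((Y2set k0 ν ω e ∩ {x | ‖x‖ < 2 * k0}) \ {x | ∃ t : ℝ, x = t • ν}) := by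
  have hrank : 1 < Module.rank ℝ (Euc d) := by
    rw [← Module.finrank_eq_rank, finrank_euclideanSpace_fin]
    exact_mod_cast hd
  constructor
  · rw [isOpen_iff_mem_nhds]
    rintro y ⟨⟨hy, hlt⟩, hyν⟩
    have hy0 : y ≠ 0 := fun h ↦ hyν ⟨0, by simp [h]⟩
    exact Filter.inter_mem (Filter.inter_mem (Y2set_mem_nhds hν hy hy0 hlt)
      ((isOpen_lt continuous_norm continuous_const).mem_nhds hlt))
      ((isClosed_setOf_eq_smul ν).isOpen_compl.mem_nhds hyν)
  · rintro _ ⟨η, ⟨hη, hηe⟩, σ, hσ, rfl⟩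
    have hσn : ‖σ‖ = k0 := hσ.1.1
    have hfreq : ∃ᶠ x in 𝓝[≠] η, x ∈ Metric.sphere (0 : Euc d) k0 :=
      accPt_iff_frequently_nhdsNE.1 (preperfect_sphere hrank hk0 η (by simpa using hη))
    have hne (z : Euc d) : ∀ᶠ x in 𝓝[≠] η, x ≠ z := by
      rcases eq_or_ne η z with rfl | h
      · exact eventually_mem_nhdsWithin
      · exact nhdsWithin_le_nhds (eventually_ne_nhds h)
    have he' : ∀ᶠ x in 𝓝[≠] η, 0 < ⟪x, e⟫ := nhdsWithin_le_nhds <|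
      continuousAt_const.eventually_lt (continuousAt_id.inner continuousAt_const) hηe
    have htend : Filter.Tendsto (fun x ↦ x - σ) (𝓝[≠] η) (𝓝 (η - σ)) :=
      (Continuous.tendsto (by fun_prop) η).mono_left nhdsWithin_le_nhds
    refine mem_closure_of_frequently_of_tendsto ((hfreq.and_eventually
      (he'.and ((hne σ).and ((hne (Hr ν σ)).and (hne (-σ)))))).mono ?_) htend
    rintro x ⟨hx, hxe, hxσ, hxH, hxn⟩
    rw [mem_sphere_zero_iff_norm] at hx
    refine ⟨⟨⟨x, ⟨hx, hxe⟩, σ, hσ, rfl⟩, norm_sub_lt_two_mul hk0 hx hσn hxn⟩, ?_⟩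
    rintro ⟨t, ht⟩
    exact (eq_or_eq_Hr_of_sub_eq_smul hν (hx.trans hσn.symm) ht).elim hxσ hxH
end

section
/- Let d = 3 and assume b is twice continuously differentiable on the open set Σ_{2,χ}. Let η ∈ S_{e_3} and σ ∈ Σ2 with η, σ, ν linearly independent, set y = η − σ and z = η − H_ν σ, and let U ⊆ ℝ³ be an open neighborhood of 0, J ⊆ ℝ an open interval containing 0, and η̂, σ̂ : U × J × J → ℝ³ smooth maps with η̂(0,0,0) = η, σ̂(0,0,0) = σ, η̂(w,δ,ε) ∈ S_{e_3}, σ̂(w,δ,ε) ∈ Σ2, y + w + δν = η̂(w,δ,ε) − σ̂(w,δ,ε), and z + w + εν = η̂(w,δ,ε) − H_ν σ̂(w,δ,ε) for all (w,δ,ε) ∈ U × J × J. If b satisfies b(σ̂(w,0,ε))·b(σ̂(w,δ,0)) = b(σ̂(w,0,0))·b(σ̂(w,δ,ε)) for all (w, δ, ε) ∈ U × J × J, then the directional derivative of b at σ in the direction of the cross product ν × σ vanishes: Db(σ)(ν × σ) = 0. -/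
open Set MeasureTheory
open scoped RealInnerProductSpace

theorem inner_eq_sum_three (x y : Euc 3) : ⟪x, y⟫ = x 0 * y 0 + x 1 * y 1 + x 2 * y 2 := by
  simp [PiLp.inner_apply, Fin.sum_univ_three, mul_comm]

theorem cross3_coords (x y : Euc 3) :
    cross3 x y 0 = x 1 * y 2 - x 2 * y 1 ∧ cross3 x y 1 = x 2 * y 0 - x 0 * y 2 ∧
      cross3 x y 2 = x 0 * y 1 - x 1 * y 0 := by
  simp [cross3]

theorem inner_cross3_left (x y : Euc 3) : ⟪cross3 x y, x⟫ = 0 := by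
  obtain ⟨h0, h1, h2⟩ := cross3_coords x y
  rw [inner_eq_sum_three, h0, h1, h2]; ring

theorem inner_cross3_right (x y : Euc 3) : ⟪cross3 x y, y⟫ = 0 := by
  obtain ⟨h0, h1, h2⟩ := cross3_coords x y
  rw [inner_eq_sum_three, h0, h1, h2]; ring

theorem inner_cross3_self (x y : Euc 3) :
    ⟪cross3 x y, cross3 x y⟫ = ⟪x, x⟫ * ⟪y, y⟫ - ⟪x, y⟫ ^ 2 := by
  obtain ⟨h0, h1, h2⟩ := cross3_coords x y
  simp only [inner_eq_sum_three, h0, h1, h2]; ring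

/-- Expansion of a vector in the basis `ν, σ, ν × σ`. -/
theorem gram_smul_eq (ν σ x : Euc 3) :
    (⟪ν, ν⟫ * ⟪σ, σ⟫ - ⟪ν, σ⟫ ^ 2) • x =
      ⟪x, ν⟫ • (⟪σ, σ⟫ • ν - ⟪ν, σ⟫ • σ) + ⟪x, σ⟫ • (⟪ν, ν⟫ • σ - ⟪ν, σ⟫ • ν) +
        ⟪x, cross3 ν σ⟫ • cross3 ν σ := by
  obtain ⟨h0, h1, h2⟩ := cross3_coords ν σ
  ext i
  fin_cases i <;>
  · simp only [inner_eq_sum_three, h0, h1, h2, PiLp.add_apply, PiLp.sub_apply, PiLp.smul_apply,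
      smul_eq_mul, Fin.mk_one, Fin.zero_eta, Fin.reduceFinMk]
    ring

theorem inner_cross3_ne_zero {η σ ν : Euc 3} (h : LinearIndependent ℝ ![η, σ, ν]) :
    ⟪η, cross3 ν σ⟫ ≠ 0 := by
  have h' : LinearIndependent ℝ (Matrix.of ![⇑η, ⇑σ, ⇑ν]).row := by
    have := h.map' (EuclideanSpace.equiv (Fin 3) ℝ).toLinearMap
      (LinearMap.ker_eq_bot.2 (EuclideanSpace.equiv (Fin 3) ℝ).injective)
    have e : (Matrix.of ![⇑η, ⇑σ, ⇑ν]).row =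
        (EuclideanSpace.equiv (Fin 3) ℝ).toLinearMap ∘ ![η, σ, ν] := by
      ext i j
      fin_cases i <;> rfl
    rw [e]
    exact this
  rw [Matrix.linearIndependent_rows_iff_isUnit, Matrix.isUnit_iff_isUnit_det,
    Matrix.det_fin_three, isUnit_iff_ne_zero] at h'
  obtain ⟨h0, h1, h2⟩ := cross3_coords ν σ
  rw [inner_eq_sum_three, h0, h1, h2]
  contrapose! h'
  simp
  linear_combination -h'

/-- The first and mixed second partial derivatives of a `C²` map at the origin of `ℝ × ℝ`. -/
theorem exists_mixed_derivatives {E : Type*} [NormedAddCommGroup E] [NormedSpace ℝ E]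
    {G : ℝ × ℝ → E} (hG : ContDiffAt ℝ 2 G (0, 0)) :
    ∃ (v : ℝ → E) (u W : E), (∀ᶠ δ in nhds (0 : ℝ), HasDerivAt (fun ε => G (δ, ε)) (v δ) 0) ∧
      HasDerivAt (fun δ => G (δ, 0)) u 0 ∧ HasDerivAt v W 0 := by
  have hline : HasDerivAt (fun δ : ℝ => (δ, (0 : ℝ))) (1, 0) 0 :=
    (hasDerivAt_id _).prodMk (hasDerivAt_const _ _)
  have hd : ∀ᶠ p in nhds ((0 : ℝ), (0 : ℝ)), DifferentiableAt ℝ G p :=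
    (hG.eventually (by simp)).mono fun p hp => hp.differentiableAt (by simp)
  have hd1 : DifferentiableAt ℝ (fderiv ℝ G) (0, 0) :=
    (hG.fderiv_right (m := 1) (by norm_num)).differentiableAt (by simp)
  refine ⟨fun δ => fderiv ℝ G (δ, 0) (0, 1), fderiv ℝ G (0, 0) (1, 0),
    fderiv ℝ (fderiv ℝ G) (0, 0) (1, 0) (0, 1), ?_, ?_, ?_⟩
  · filter_upwards [hline.continuousAt.eventually hd] with δ hδ
    exact hδ.hasFDerivAt.comp_hasDerivAt (0 : ℝ)
      ((hasDerivAt_const _ _).prodMk (hasDerivAt_id _))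
  · exact hd.self_of_nhds.hasFDerivAt.comp_hasDerivAt_of_eq (0 : ℝ) hline rfl
  · exact (hd1.hasFDerivAt.comp_hasDerivAt_of_eq (0 : ℝ) hline rfl).clm_apply (hasDerivAt_const _ _)
      |>.congr_deriv (by simp)

/-- Implicit differentiation, to second order, of the two sphere constraints, the height constraint
and the determinant condition. -/
theorem derivative_relations {E : Type*} [NormedAddCommGroup E] [InnerProductSpace ℝ E]
    {b : E → ℂ} {ν σ η : E} {k s : ℝ} {G : ℝ × ℝ → E}
    (hb : ContDiffAt ℝ 2 b σ) (hG : ContDiffAt ℝ 2 G (0, 0)) (hG0 : G (0, 0) = σ)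
    (h1 : ∀ᶠ p in nhds ((0 : ℝ), (0 : ℝ)), ⟪G p, G p⟫ = k)
    (h2 : ∀ᶠ p in nhds ((0 : ℝ), (0 : ℝ)),
      ⟪G p + (η - σ) + p.1 • ν, G p + (η - σ) + p.1 • ν⟫ = k)
    (h3 : ∀ᶠ p in nhds ((0 : ℝ), (0 : ℝ)), ⟪G p, ν⟫ = s + (p.2 - p.1) / 2)
    (h4 : ∀ᶠ p in nhds ((0 : ℝ), (0 : ℝ)), b (G (0, p.2)) * b (G (p.1, 0)) = b σ * b (G p)) :
    ∃ u v W : E, ⟪u, σ⟫ = 0 ∧ ⟪u, ν⟫ = -1 / 2 ∧ ⟪η, u + ν⟫ = 0 ∧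
      ⟪v, σ⟫ = 0 ∧ ⟪v, ν⟫ = 1 / 2 ∧ ⟪η, v⟫ = 0 ∧
      ⟪W, σ⟫ = -⟪u, v⟫ ∧ ⟪W, ν⟫ = 0 ∧ ⟪η, W⟫ = -⟪u + ν, v⟫ ∧
      fderiv ℝ b σ v * fderiv ℝ b σ u =
        b σ * (fderiv ℝ (fderiv ℝ b) σ u v + fderiv ℝ b σ W) := by
  obtain ⟨v, u, W, hv, hu, hW⟩ := exists_mixed_derivatives hG
  have hv0 := hv.self_of_nhds
  have hcont : Filter.Tendsto (fun δ : ℝ => (δ, (0 : ℝ))) (nhds 0) (nhds (0, 0)) :=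
    (Continuous.prodMk_left (0 : ℝ)).tendsto _
  have hbd : ∀ᶠ x in nhds σ, DifferentiableAt ℝ b x :=
    (hb.eventually (by simp)).mono fun p hp => hp.differentiableAt (by simp)
  have hb1 : DifferentiableAt ℝ (fderiv ℝ b) σ :=
    (hb.fderiv_right (m := 1) (by norm_num)).differentiableAt (by simp)
  have hb0 := hbd.self_of_nhds
  have hu' : HasDerivAt (fun δ => G (δ, 0) + (η - σ) + δ • ν) (u + ν) 0 := by
    have := (hu.add_const (η - σ)).add ((hasDerivAt_id (0 : ℝ)).smul_const ν)
    rwa [one_smul] at this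
  have e1 : (fun δ => ⟪G (δ, 0), v δ⟫) =ᶠ[nhds 0] fun _ => 0 := by
    filter_upwards [hv, h1.curry_nhds] with δ hδ h
    have := (hδ.inner ℝ hδ).unique ((hasDerivAt_const (0 : ℝ) k).congr_of_eventuallyEq h)
    rw [real_inner_comm (G (δ, 0))] at this
    linarith
  have e2 : (fun δ => ⟪G (δ, 0) + (η - σ) + δ • ν, v δ⟫) =ᶠ[nhds 0] fun _ => 0 := by
    filter_upwards [hv, h2.curry_nhds] with δ hδ h
    have hδ' := (hδ.add_const (η - σ)).add_const (δ • ν)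
    have := (hδ'.inner ℝ hδ').unique ((hasDerivAt_const (0 : ℝ) k).congr_of_eventuallyEq h)
    rw [real_inner_comm (G (δ, 0) + _ + _)] at this
    linarith
  have e3 : (fun δ => ⟪v δ, ν⟫) =ᶠ[nhds 0] fun _ => 1 / 2 := by
    filter_upwards [hv, h3.curry_nhds] with δ hδ h
    have h' : HasDerivAt (fun ε : ℝ => s + (ε - δ) / 2) (1 / 2) 0 :=
      (((hasDerivAt_id (0 : ℝ)).sub_const δ).div_const 2).const_add s
    have := (hδ.inner ℝ (hasDerivAt_const (0 : ℝ) ν)).unique (h'.congr_of_eventuallyEq h)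
    simpa using this
  have e4 : (fun δ => fderiv ℝ b σ (v 0) * b (G (δ, 0))) =ᶠ[nhds 0]
      fun δ => b σ * fderiv ℝ b (G (δ, 0)) (v δ) := by
    have hc : Filter.Tendsto (fun δ : ℝ => G (δ, 0)) (nhds 0) (nhds σ) := by
      simpa [hG0] using hu.continuousAt.tendsto
    filter_upwards [hv, h4.curry_nhds, hc.eventually hbd] with δ hδ h hd
    have l := (hb0.hasFDerivAt.comp_hasDerivAt_of_eq (0 : ℝ) hv0 hG0.symm).mul_const (b (G (δ, 0)))
    have r := (HasFDerivAt.comp_hasDerivAt (0 : ℝ) hd.hasFDerivAt hδ).const_mul (b σ)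
    exact l.unique (r.congr_of_eventuallyEq h)
  have d1 := (hu.inner ℝ hW).unique ((hasDerivAt_const (0 : ℝ) (0 : ℝ)).congr_of_eventuallyEq e1)
  have d2 := (hu'.inner ℝ hW).unique ((hasDerivAt_const (0 : ℝ) (0 : ℝ)).congr_of_eventuallyEq e2)
  have d3 := (hW.inner ℝ (hasDerivAt_const (0 : ℝ) ν)).unique
    ((hasDerivAt_const (0 : ℝ) (1 / 2 : ℝ)).congr_of_eventuallyEq e3)
  have h1' : (fun δ => ⟪G (δ, 0), G (δ, 0)⟫) =ᶠ[nhds 0] fun _ => k := hcont.eventually h1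
  have h2' : (fun δ => ⟪G (δ, 0) + (η - σ) + δ • ν, G (δ, 0) + (η - σ) + δ • ν⟫) =ᶠ[nhds 0]
      fun _ => k := hcont.eventually h2
  have h3' : (fun δ => ⟪G (δ, 0), ν⟫) =ᶠ[nhds 0] fun δ => s + (0 - δ) / 2 :=
    hcont.eventually h3
  have c1 := (hu.inner ℝ hu).unique
    ((hasDerivAt_const (0 : ℝ) k).congr_of_eventuallyEq h1')
  have c2 := (hu'.inner ℝ hu').unique
    ((hasDerivAt_const (0 : ℝ) k).congr_of_eventuallyEq h2')
  have hs : HasDerivAt (fun δ : ℝ => s + (0 - δ) / 2) (-1 / 2) 0 :=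
    (((hasDerivAt_id (0 : ℝ)).const_sub 0).div_const 2).const_add s
  have c3 := (hu.inner ℝ (hasDerivAt_const (0 : ℝ) ν)).unique
    (hs.congr_of_eventuallyEq h3')
  have d4 : fderiv ℝ b σ (v 0) * fderiv ℝ b σ u =
        b σ * (fderiv ℝ (fderiv ℝ b) σ u (v 0) + fderiv ℝ b σ W) := by
    have l := (hb0.hasFDerivAt.comp_hasDerivAt_of_eq (0 : ℝ) hu hG0.symm).const_mul
      (fderiv ℝ b σ (v 0))
    have hL : HasDerivAt (fun δ => fderiv ℝ b (G (δ, 0))) (fderiv ℝ (fderiv ℝ b) σ u) 0 :=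
      hb1.hasFDerivAt.comp_hasDerivAt_of_eq (0 : ℝ) hu hG0.symm
    have r := (hL.clm_apply hW).const_mul (b σ)
    have := l.unique (r.congr_of_eventuallyEq e4)
    rwa [hG0] at this
  have e1' := e1.self_of_nhds
  have e2' := e2.self_of_nhds
  have e3' := e3.self_of_nhds
  simp only [hG0, zero_smul, add_zero, add_sub_cancel, inner_zero_right, zero_add]
    at d1 d2 d3 c1 c2 c3 e1' e2' e3'
  refine ⟨u, v 0, W, ?_, ?_, ?_, ?_, e3', e2', ?_, d3, ?_, d4⟩
  · rw [real_inner_comm] at c1; linarith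
  · linarith
  · rw [real_inner_comm η] at c2; linarith
  · rwa [real_inner_comm]
  · rw [real_inner_comm]; linarith
  · linarith

theorem eq_dual_basis_expansion {ν σ : Euc 3} {k s r : ℝ} (hν : ⟪ν, ν⟫ = 1) (hσ : ⟪σ, σ⟫ = k)
    (hs : ⟪ν, σ⟫ = s) (hr : r = k - s ^ 2) (hr0 : r ≠ 0) (x : Euc 3) :
    x = ⟪x, ν⟫ • r⁻¹ • (k • ν - s • σ) + ⟪x, σ⟫ • r⁻¹ • (σ - s • ν) +
      (⟪x, cross3 ν σ⟫ / r) • cross3 ν σ := by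
  have h := gram_smul_eq ν σ x
  rw [hν, hσ, hs, one_mul, ← hr, one_smul] at h
  have h' := congrArg (fun z => r⁻¹ • z) h
  simp only [smul_smul, inv_mul_cancel₀ hr0, one_smul] at h'
  rw [div_eq_inv_mul]
  exact h'.trans (by module)

theorem inner_self_relation {ν σ : Euc 3} {k s r : ℝ} (hν : ⟪ν, ν⟫ = 1) (hσ : ⟪σ, σ⟫ = k)
    (hs : ⟪ν, σ⟫ = s) (hr : r = k - s ^ 2) (x : Euc 3) :
    r * (⟪x, x⟫ - ⟪x, ν⟫ ^ 2) = (⟪x, σ⟫ - s * ⟪x, ν⟫) ^ 2 + ⟪x, cross3 ν σ⟫ ^ 2 := by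
  have h := congrArg (fun z => ⟪x, z⟫) (gram_smul_eq ν σ x)
  simp only [inner_add_right, inner_smul_right, inner_sub_right, hν, hσ, hs] at h
  rw [hr]
  linear_combination h

theorem scalar_relation {k s r t X D α β γ n : ℝ} {b₀ ℓ lf Mee Mem Mmm : ℂ}
    (hr : r = k - s ^ 2) (hr0 : r ≠ 0) (ht : t ^ 2 = k - (X ^ 2 + D ^ 2) / r)
    (hα : α * D = -t / 2 - s * X / (2 * r)) (hβ : β * D = -t / 2 + s * X / (2 * r))
    (hn : n = -k / (4 * r) + α * β * r) (hγ : γ * D = n * (X / r - 1) - 1 / 2)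
    (hM : -Mee / 4 + (α - β) / 2 * Mem + α * β * Mmm + b₀ * (-n * lf + γ * ℓ) = 0) :
    b₀ * ℓ * (k / 4 * (1 - X ^ 2 / r ^ 2) * (X - r) : ℝ) +
      ((k / 4 * (1 - X ^ 2 / r ^ 2) : ℝ) * (Mmm - b₀ * lf * r)) * D +
      ((-s * X / (2 * r) : ℝ) * Mem +
        b₀ * ℓ * (-(k / (4 * r) + 1 / 4) * (X / r - 1) - 1 / 2 : ℝ)) * D ^ 2 +
      (-Mmm * (1 / (4 * r) : ℝ) - Mee / 4 + b₀ * lf * (k / (4 * r) + 1 / 4 : ℝ)) * D ^ 3 = 0 := by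
  set a : ℝ := k / 4 * (1 - X ^ 2 / r ^ 2) with ha
  have h1 : α * β * D ^ 2 = a - 1 / (4 * r) * D ^ 2 := by
    have : α * β * D ^ 2 = (t ^ 2 - s ^ 2 * X ^ 2 / r ^ 2) / 4 := by
      linear_combination (β * D) * hα + (-t / 2 - s * X / (2 * r)) * hβ
    have hs : s ^ 2 = k - r := by linarith
    rw [this, ht, hs, ha]
    field_simp
    ring
  have h2 : n * D ^ 2 = a * r - (k / (4 * r) + 1 / 4) * D ^ 2 := by
    have : 1 / (4 * r) * r = 1 / 4 := by field_simp
    linear_combination D ^ 2 * hn + r * h1 - D ^ 2 * this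
  have h3 : γ * D ^ 3 = a * (X - r) +
      (-(k / (4 * r) + 1 / 4) * (X / r - 1) - 1 / 2) * D ^ 2 := by
    have : r * (X / r - 1) = X - r := by field_simp
    linear_combination D ^ 2 * hγ + (X / r - 1) * h2 + a * this
  have h4 : (α - β) / 2 * D ^ 3 = -s * X / (2 * r) * D ^ 2 := by
    linear_combination D ^ 2 / 2 * hα - D ^ 2 / 2 * hβ
  have h1' := congrArg ((↑) : ℝ → ℂ) h1
  have h2' := congrArg ((↑) : ℝ → ℂ) h2
  have h3' := congrArg ((↑) : ℝ → ℂ) h3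
  have h4' := congrArg ((↑) : ℝ → ℂ) h4
  clear_value a
  push_cast at h1' h2' h3' h4' ⊢
  linear_combination (D : ℂ) ^ 3 * hM - Mmm * D * h1' + b₀ * lf * D * h2' - b₀ * ℓ * h3' - Mem * h4'

/-- The differentiated relation, as a cubic in `⟪η, ν × σ⟫` whose coefficients depend on `η` only
through `⟪η, σ⟫ - ⟪ν, σ⟫ * ⟪η, ν⟫`. -/
theorem cubic_relation {ν σ : Euc 3} {k s r : ℝ} (hν : ⟪ν, ν⟫ = 1) (hσ : ⟪σ, σ⟫ = k)
    (hs : ⟪ν, σ⟫ = s) (hr : r = k - s ^ 2) (hr0 : r ≠ 0) (b₀ : ℂ) (L : Euc 3 →L[ℝ] ℂ)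
    (Q : Euc 3 →L[ℝ] Euc 3 →L[ℝ] ℂ) (hQ : ∀ x y, Q x y = Q y x) (X : ℝ) :
    ∃ c₁ c₂ c₃ : ℂ, ∀ η u v W : Euc 3, ⟪η, η⟫ = k → ⟪η, σ⟫ - s * ⟪η, ν⟫ = X →
      ⟪u, σ⟫ = 0 → ⟪u, ν⟫ = -1 / 2 → ⟪η, u + ν⟫ = 0 →
      ⟪v, σ⟫ = 0 → ⟪v, ν⟫ = 1 / 2 → ⟪η, v⟫ = 0 →
      ⟪W, σ⟫ = -⟪u, v⟫ → ⟪W, ν⟫ = 0 → ⟪η, W⟫ = -⟪u + ν, v⟫ →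
      L v * L u = b₀ * (Q u v + L W) →
      b₀ * L (cross3 ν σ) * (k / 4 * (1 - X ^ 2 / r ^ 2) * (X - r) : ℝ) +
        c₁ * (⟪η, cross3 ν σ⟫ : ℝ) + c₂ * (⟪η, cross3 ν σ⟫ : ℝ) ^ 2 +
        c₃ * (⟪η, cross3 ν σ⟫ : ℝ) ^ 3 = 0 := by
  set m := cross3 ν σ with hm
  have hmν : ⟪m, ν⟫ = 0 := inner_cross3_left ν σ
  have hmσ : ⟪m, σ⟫ = 0 := inner_cross3_right ν σ
  have hmm : ⟪m, m⟫ = r := by rw [hm, inner_cross3_self, hν, hσ, hs, hr, one_mul]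
  have hexp := eq_dual_basis_expansion hν hσ hs hr hr0
  rw [← hm] at hexp
  set e := r⁻¹ • (k • ν - s • σ) with he
  set f := r⁻¹ • (σ - s • ν) with hf
  clear_value e f
  have hme : ⟪m, e⟫ = 0 := by
    simp only [he, inner_smul_right, inner_sub_right, hmν, hmσ]; ring
  have hee : ⟪e, e⟫ = k / r := by
    simp only [he, inner_smul_right, inner_sub_right, inner_smul_left, inner_sub_left, hν, hσ, hs,
      real_inner_comm ν σ, conj_trivial]
    field_simp
    rw [hr]; ring
  refine ⟨(k / 4 * (1 - X ^ 2 / r ^ 2) : ℝ) * ((b₀ * Q m m - L m * L m) - b₀ * L f * r),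
    (-s * X / (2 * r) : ℝ) * (b₀ * Q e m - L e * L m) +
      b₀ * L m * (-(k / (4 * r) + 1 / 4) * (X / r - 1) - 1 / 2 : ℝ),
    -(b₀ * Q m m - L m * L m) * (1 / (4 * r) : ℝ) - (b₀ * Q e e - L e * L e) / 4 +
      b₀ * L f * (k / (4 * r) + 1 / 4 : ℝ), ?_⟩
  intro η u v W hη hX huσ huν hηu hvσ hvν hηv hWσ hWν hηW hE
  have hu := hexp u
  have hv := hexp v
  have hW := hexp W
  rw [huσ, huν, zero_smul, add_zero] at hu
  rw [hvσ, hvν, zero_smul, add_zero] at hv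
  rw [hWσ, hWν, zero_smul, zero_add] at hW
  set α := ⟪u, m⟫ / r
  set β := ⟪v, m⟫ / r
  set γ := ⟪W, m⟫ / r
  set t := ⟪η, ν⟫ with ht
  have hησ : ⟪η, σ⟫ = X + s * t := by linarith
  have hηe : ⟪η, e⟫ = t - s * X / r := by
    simp only [he, inner_smul_right, inner_sub_right, hησ, ← ht]
    field_simp
    rw [hr]; ring
  have hηf : ⟪η, f⟫ = X / r := by
    simp only [hf, inner_smul_right, inner_sub_right, hησ, ← ht]
    field_simp
    ring
  rw [inner_add_left, real_inner_comm v ν, hvν] at hηW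
  rw [inner_add_right, ← ht] at hηu
  have hn : ⟪u, v⟫ = -k / (4 * r) + α * β * r := by
    rw [hu, hv]
    simp only [inner_add_left, inner_add_right, inner_smul_left, inner_smul_right, hee, hmm, hme,
      real_inner_comm m e, conj_trivial]
    field_simp
    ring
  refine scalar_relation (t := t) (α := α) (β := β) (γ := γ) (n := ⟪u, v⟫) hr hr0 ?_ ?_ ?_ hn ?_ ?_
  · have h := inner_self_relation hν hσ hs hr η
    rw [hX, hη] at h
    field_simp
    linear_combination -h
  · have h := hηu
    rw [hu, inner_add_right, inner_smul_right, inner_smul_right, hηe] at h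
    linear_combination h
  · have h := hηv
    rw [hv, inner_add_right, inner_smul_right, inner_smul_right, hηe] at h
    linear_combination h
  · have h := hηW
    rw [hW, inner_add_right, inner_smul_right, inner_smul_right, hηf] at h
    linear_combination h
  · generalize ⟪u, v⟫ = n at *
    have hLW : L W = -n * L f + γ * L m := by
      rw [hW]; simp
    have hLu : L u = -1 / 2 * L e + α * L m := by
      rw [hu]; simp
    have hLv : L v = 1 / 2 * L e + β * L m := by
      rw [hv]; simp
    have hQuv : Q u v = -Q e e / 4 + (α - β) / 2 * Q e m + α * β * Q m m := by
      rw [hu, hv]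
      simp [hQ m e]
      ring
    rw [hLW, hLu, hLv, hQuv] at hE
    linear_combination -hE

theorem cubic_constant_coeff_eq_zero {c₀ c₁ c₂ c₃ : ℂ} {S : Set ℝ} (hS : S.Infinite)
    (h : ∀ x ∈ S, c₀ + c₁ * x + c₂ * x ^ 2 + c₃ * x ^ 3 = 0) : c₀ = 0 := by
  open Polynomial in
  have hp : (C c₀ + C c₁ * X + C c₂ * X ^ 2 + C c₃ * X ^ 3 : ℂ[X]) = 0 := by
    refine Polynomial.eq_zero_of_infinite_isRoot _
      ((hS.image Complex.ofReal_injective.injOn).mono ?_)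
    rintro _ ⟨x, hx, rfl⟩
    simpa [Polynomial.IsRoot] using h x hx
  simpa using congrArg (Polynomial.eval 0) hp

theorem eq_of_inner_constraints {ν σ η h : Euc 3} {k s r : ℝ} (hν : ⟪ν, ν⟫ = 1)
    (hσ : ⟪σ, σ⟫ = k) (hs : ⟪ν, σ⟫ = s) (hr : r = k - s ^ 2)
    (hhν : ⟪h, ν⟫ = 0) (hhσ : ⟪σ + h, σ + h⟫ = ⟪σ, σ⟫) (hhη : ⟪η + h, η + h⟫ = ⟪η, η⟫)
    (hsmall : ⟪h, h⟫ * (⟪η, cross3 ν σ⟫ ^ 2 + (r - (⟪η, σ⟫ - s * ⟪η, ν⟫)) ^ 2) <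
      4 * r * ⟪η, cross3 ν σ⟫ ^ 2) : h = 0 := by
  have h1 := inner_self_relation hν hσ hs hr h
  have h2 := congrArg (fun z => ⟪η, z⟫) (gram_smul_eq ν σ h)
  simp only [inner_add_right, inner_smul_right, inner_sub_right, hν, hσ, hs, hhν] at h1 h2
  rw [real_inner_add_add_self] at hhσ hhη
  have hS : ⟪h, σ⟫ = -⟪h, h⟫ / 2 := by linarith [real_inner_comm h σ]
  have hE : ⟪η, h⟫ = -⟪h, h⟫ / 2 := by linarith
  rw [hS] at h1 h2
  rw [hE] at h2
  rw [← inner_self_eq_zero (𝕜 := ℝ)]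
  generalize ⟪h, h⟫ = q at *
  generalize ⟪η, cross3 ν σ⟫ = D at *
  generalize ⟪h, cross3 ν σ⟫ = M at *
  set X := ⟪η, σ⟫ - s * ⟪η, ν⟫ with hX
  have hMD : M * D = -q / 2 * (r - X) := by
    rw [hX]; linear_combination -h2 + q / 2 * hr
  have key : q * (q * (D ^ 2 + (r - X) ^ 2) - 4 * r * D ^ 2) = 0 := by
    linear_combination -4 * D ^ 2 * h1 - 4 * (M * D - q / 2 * (r - X)) * hMD
  exact (mul_eq_zero.1 key).resolve_right (by linarith)

theorem exists_sphere_perturbation {ν σ η : Euc 3} {k s r : ℝ} (hν : ⟪ν, ν⟫ = 1)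
    (hσ : ⟪σ, σ⟫ = k) (hs : ⟪ν, σ⟫ = s) (hr : r = k - s ^ 2) (hr0 : 0 < r) (hη : ⟪η, η⟫ = k) :
    ∃ N : ℝ × ℝ → Euc 3, Continuous N ∧ N (0, 0) = η ∧
      ∀ p : ℝ × ℝ, p.1 ∈ Icc (0 : ℝ) 1 → p.2 ∈ Icc (0 : ℝ) 1 → ⟪N p, N p⟫ = k ∧
        ⟪N p, σ⟫ - s * ⟪N p, ν⟫ = (1 - p.1) * (⟪η, σ⟫ - s * ⟪η, ν⟫) ∧
        ⟪N p, cross3 ν σ⟫ = (1 - p.2) * ⟪η, cross3 ν σ⟫ := by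
  obtain ⟨sg, hsg, hsg'⟩ : ∃ sg : ℝ, sg ^ 2 = 1 ∧ sg * |⟪η, ν⟫| = ⟪η, ν⟫ := by
    rcases abs_cases ⟪η, ν⟫ with ⟨h, -⟩ | ⟨h, -⟩
    · exact ⟨1, by norm_num, by rw [h]; ring⟩
    · exact ⟨-1, by norm_num, by rw [h]; ring⟩
  have hrel := inner_self_relation hν hσ hs hr η
  have hexp := eq_dual_basis_expansion hν hσ hs hr hr0.ne' η
  rw [hη] at hrel
  have hmν : ⟪cross3 ν σ, ν⟫ = 0 := inner_cross3_left ν σ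
  have hmσ : ⟪cross3 ν σ, σ⟫ = 0 := inner_cross3_right ν σ
  have hmm : ⟪cross3 ν σ, cross3 ν σ⟫ = r := by rw [inner_cross3_self, hν, hσ, hs, hr, one_mul]
  have hσν : ⟪σ, ν⟫ = s := by rw [real_inner_comm, hs]
  have hσm : ⟪σ, cross3 ν σ⟫ = 0 := by rw [real_inner_comm, hmσ]
  have hνm : ⟪ν, cross3 ν σ⟫ = 0 := by rw [real_inner_comm, hmν]
  set m := cross3 ν σ
  set t := ⟪η, ν⟫
  set D := ⟪η, m⟫
  set X := ⟪η, σ⟫ - s * t with hX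
  let T : ℝ × ℝ → ℝ := fun p => sg * √(k - (((1 - p.1) * X) ^ 2 + ((1 - p.2) * D) ^ 2) / r)
  let N : ℝ × ℝ → Euc 3 := fun p =>
    T p • ν + ((1 - p.1) * X) • r⁻¹ • (σ - s • ν) + ((1 - p.2) * D / r) • m
  have hNν : ∀ p, ⟪N p, ν⟫ = T p := fun p => by
    simp only [N, inner_add_left, inner_smul_left, inner_sub_left, hν, hσν, hmν, conj_trivial]
    ring
  have hNσ : ∀ p, ⟪N p, σ⟫ - s * ⟪N p, ν⟫ = (1 - p.1) * X := fun p => by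
    rw [hNν]
    simp only [N, inner_add_left, inner_smul_left, inner_sub_left, hs, hσ, hmσ, conj_trivial]
    have : k = r + s ^ 2 := by linarith
    rw [this]
    field_simp
    ring
  have hNm : ∀ p, ⟪N p, m⟫ = (1 - p.2) * D := fun p => by
    simp only [N, inner_add_left, inner_smul_left, inner_sub_left, hσm, hνm, hmm, conj_trivial]
    field_simp
    ring
  refine ⟨N, by fun_prop, ?_, fun p h1 h2 => ⟨?_, hNσ p, hNm p⟩⟩
  · have hT : T (0, 0) = t := by
      have : k - (((1 - 0) * X) ^ 2 + ((1 - 0) * D) ^ 2) / r = t ^ 2 := by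
        field_simp
        linear_combination hrel
      simp only [T, this, Real.sqrt_sq_eq_abs, hsg']
    simp only [N, hT]
    conv_rhs => rw [hexp]
    have hk : k = r + s ^ 2 := by linarith
    have hησ : ⟪η, σ⟫ = X + s * t := by rw [hX]; ring
    rw [hησ, hk]
    have : t • ν = (r⁻¹ * r * t) • ν := by rw [inv_mul_cancel₀ hr0.ne', one_mul]
    simp only [sub_zero, one_mul]
    rw [this]
    module
  · have hTsq : r * T p ^ 2 = r * k - (((1 - p.1) * X) ^ 2 + ((1 - p.2) * D) ^ 2) := by
      have hX2 : ((1 - p.1) * X) ^ 2 ≤ X ^ 2 := by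
        rw [mul_pow]
        exact mul_le_of_le_one_left (sq_nonneg _)
          (pow_le_one₀ (by linarith [h1.2]) (by linarith [h1.1]))
      have hD2 : ((1 - p.2) * D) ^ 2 ≤ D ^ 2 := by
        rw [mul_pow]
        exact mul_le_of_le_one_left (sq_nonneg _)
          (pow_le_one₀ (by linarith [h2.2]) (by linarith [h2.1]))
      have hnn : 0 ≤ k - (((1 - p.1) * X) ^ 2 + ((1 - p.2) * D) ^ 2) / r := by
        rw [sub_nonneg, div_le_iff₀ hr0]
        nlinarith [mul_nonneg hr0.le (sq_nonneg t)]
      simp only [T]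
      rw [mul_pow, hsg, Real.sq_sqrt hnn]
      field_simp
    have h := inner_self_relation hν hσ hs hr (N p)
    rw [hNσ, hNν, hNm] at h
    have : r * ⟪N p, N p⟫ = r * k := by linear_combination h + hTsq
    exact mul_left_cancel₀ hr0.ne' this

theorem inner_Hr_self {d : ℕ} {ν : Euc d} (hν : ⟪ν, ν⟫ = 1) (x : Euc d) :
    ⟪Hr ν x, Hr ν x⟫ = ⟪x, x⟫ := by
  simp only [Hr, inner_sub_left, inner_sub_right, inner_smul_left, inner_smul_right, hν,
    conj_trivial, real_inner_comm x ν]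
  ring

theorem Hr_smul {d : ℕ} (ν x : Euc d) (t : ℝ) : Hr ν (t • x) = t • Hr ν x := by
  simp only [Hr, inner_smul_left, conj_trivial]
  module

theorem Sig2_subset_Sig2chi {d : ℕ} {k0 χ : ℝ} (hχ : χ ∈ Ioo (0 : ℝ) 1) {ν ω σ : Euc d}
    (hσ : σ ∈ Sig2 k0 ν ω) : σ ∈ Sig2chi k0 χ ν ω :=
  ⟨σ, hσ, 1, ⟨by linarith [hχ.1], by linarith [hχ.1]⟩, (one_smul ℝ σ).symm⟩

theorem Sig2chi_mem_nhds {d : ℕ} {k0 χ : ℝ} (hk0 : 0 < k0) (hχ : χ ∈ Ioo (0 : ℝ) 1)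
    {ν ω σ : Euc d} (hν : ⟪ν, ν⟫ = 1) (hσ : σ ∈ Sig2 k0 ν ω) : Sig2chi k0 χ ν ω ∈ nhds σ := by
  obtain ⟨⟨hn, hω⟩, -, hω'⟩ := hσ
  have c1 : ContinuousAt (fun x : Euc d => ‖x‖) σ := by fun_prop
  have c2 : ContinuousAt (fun x : Euc d => ⟪x, ω⟫) σ := by fun_prop
  have c3 : ContinuousAt (fun x : Euc d => ⟪Hr ν x, ω⟫) σ := by unfold Hr; fun_prop
  have hlo : k0 * (1 - χ) < ‖σ‖ := by rw [hn]; nlinarith [hχ.1]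
  have hhi : ‖σ‖ < k0 * (1 + χ) := by rw [hn]; nlinarith [hχ.1]
  filter_upwards [c1.eventually (Ioo_mem_nhds hlo hhi), c2.eventually (lt_mem_nhds hω),
    c3.eventually (lt_mem_nhds hω')] with x hx h2 h3
  have hx0 : 0 < ‖x‖ := lt_of_le_of_lt (mul_nonneg hk0.le (by linarith [hχ.2])) hx.1
  have hq : 0 < k0 / ‖x‖ := div_pos hk0 hx0
  have hnx : ∀ z : Euc d, ‖z‖ = ‖x‖ → ‖(k0 / ‖x‖) • z‖ = k0 := fun z hz => by
    rw [norm_smul, Real.norm_of_nonneg hq.le, hz, div_mul_cancel₀ _ hx0.ne']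
  have hpos : ∀ z : Euc d, 0 < ⟪z, ω⟫ → 0 < ⟪(k0 / ‖x‖) • z, ω⟫ := fun z hz => by
    rw [real_inner_smul_left]; exact mul_pos hq hz
  have hHr : ‖Hr ν x‖ = ‖x‖ := by
    rw [norm_eq_sqrt_real_inner, norm_eq_sqrt_real_inner, inner_Hr_self hν]
  refine ⟨(k0 / ‖x‖) • x, ⟨⟨hnx x rfl, hpos x h2⟩, ?_⟩, ‖x‖ / k0, ⟨?_, ?_⟩, ?_⟩
  · rw [Hr_smul]
    exact ⟨hnx _ hHr, hpos _ h3⟩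
  · rw [lt_div_iff₀ hk0]; linarith [hx.1]
  · rw [div_lt_iff₀ hk0]; linarith [hx.2]
  · rw [smul_smul, div_mul_div_cancel₀ hk0.ne', div_self hx0.ne', one_smul]

/-- if the determinant of the 4×4 system vanishes identically,
then `Db(σ)(ν × σ) = 0`. -/
theorem stmt12 (k0 : ℝ) (hk0 : 0 < k0)
    (ν ω : Euc 3) (hν : ‖ν‖ = 1) (hω : ‖ω‖ = 1)
    (χ : ℝ) (hχ : χ ∈ Set.Ioo (0 : ℝ) 1)
    (b : Euc 3 → ℂ) (hb : BHyp k0 χ ν ω b)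
    (hb2 : ContDiffOn ℝ 2 b (Sig2chi k0 χ ν ω))
    (η σ : Euc 3) (hη : η ∈ Shemi k0 e3) (hσ : σ ∈ Sig2 k0 ν ω)
    (hind : LinearIndependent ℝ ![η, σ, ν])
    (y z : Euc 3) (hy : y = η - σ) (hz : z = η - Hr ν σ)
    (U : Set (Euc 3)) (hU : IsOpen U) (hU0 : (0 : Euc 3) ∈ U)
    (a c : ℝ) (ha : a < 0) (hc : 0 < c)
    (ηhat σhat : Euc 3 × ℝ × ℝ → Euc 3)
    (hηsm : ContDiffOn ℝ (⊤ : ℕ∞) ηhat (U ×ˢ Set.Ioo a c ×ˢ Set.Ioo a c))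
    (hσsm : ContDiffOn ℝ (⊤ : ℕ∞) σhat (U ×ˢ Set.Ioo a c ×ˢ Set.Ioo a c))
    (hη0 : ηhat (0, 0, 0) = η) (hσ0 : σhat (0, 0, 0) = σ)
    (hprop : ∀ w ∈ U, ∀ δ ∈ Set.Ioo a c, ∀ ε ∈ Set.Ioo a c,
      ηhat (w, δ, ε) ∈ Shemi k0 e3 ∧
      σhat (w, δ, ε) ∈ Sig2 k0 ν ω ∧
      y + w + δ • ν = ηhat (w, δ, ε) - σhat (w, δ, ε) ∧
      z + w + ε • ν = ηhat (w, δ, ε) - Hr ν (σhat (w, δ, ε)))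
    (hdet : ∀ w ∈ U, ∀ δ ∈ Set.Ioo a c, ∀ ε ∈ Set.Ioo a c,
      b (σhat (w, 0, ε)) * b (σhat (w, δ, 0)) =
        b (σhat (w, 0, 0)) * b (σhat (w, δ, ε))) :
    fderiv ℝ b σ (cross3 ν σ) = 0 := by
  have hνν : ⟪ν, ν⟫ = 1 := by rw [real_inner_self_eq_norm_sq, hν, one_pow]
  have hσσ : ⟪σ, σ⟫ = k0 ^ 2 := by rw [real_inner_self_eq_norm_sq, hσ.1.1]
  have hηη : ⟪η, η⟫ = k0 ^ 2 := by rw [real_inner_self_eq_norm_sq, hη.1]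
  have hbσ : ContDiffAt ℝ 2 b σ := hb2.contDiffAt (Sig2chi_mem_nhds hk0 hχ hνν hσ)
  have hb0 : b σ ≠ 0 := hb.1 σ (Sig2_subset_Sig2chi hχ hσ)
  have hQ : ∀ x y, fderiv ℝ (fderiv ℝ b) σ x y = fderiv ℝ (fderiv ℝ b) σ y x :=
    fun x y => hbσ.isSymmSndFDerivAt (by simp) x y
  have hD : ⟪η, cross3 ν σ⟫ ≠ 0 := inner_cross3_ne_zero hind
  obtain ⟨s, hs⟩ : ∃ s, s = ⟪ν, σ⟫ := ⟨_, rfl⟩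
  obtain ⟨r, hr⟩ : ∃ r, r = k0 ^ 2 - s ^ 2 := ⟨_, rfl⟩
  have hr0 : 0 < r := by
    have hm : cross3 ν σ ≠ 0 := fun h => hD (by rw [h, inner_zero_right])
    have := real_inner_self_pos.2 hm
    rwa [inner_cross3_self, hνν, hσσ, ← hs, one_mul, ← hr] at this
  have hσhat_ν : ∀ w ∈ U, ∀ δ ∈ Ioo a c, ∀ ε ∈ Ioo a c,
      ⟪σhat (w, δ, ε), ν⟫ = s + (ε - δ) / 2 := by
    intro w hw δ hδ ε hε
    obtain ⟨-, -, h1, h2⟩ := hprop w hw δ hδ ε hε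
    rw [hy] at h1
    rw [hz] at h2
    have h := congrArg (fun x => ⟪x, ν⟫) h1
    have h' := congrArg (fun x => ⟪x, ν⟫) h2
    simp only [Hr, inner_add_left, inner_sub_left, inner_smul_left, hνν, conj_trivial] at h h'
    rw [real_inner_comm] at hs
    linarith
  have h0 : (0 : ℝ) ∈ Ioo a c := ⟨ha, hc⟩
  have hopen : IsOpen (U ×ˢ Ioo a c ×ˢ Ioo a c) := hU.prod (isOpen_Ioo.prod isOpen_Ioo)
  have hσat : ∀ w ∈ U, ContDiffAt ℝ 2 σhat (w, 0, 0) := fun w hw =>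
    (hσsm.contDiffAt (hopen.mem_nhds ⟨hw, h0, h0⟩)).of_le
      (WithTop.coe_le_coe.2 (le_top : (2 : ℕ∞) ≤ ⊤))
  obtain ⟨N, hNc, hN0, hN⟩ := exists_sphere_perturbation hνν hσσ hs.symm hr hr0 hηη
  have hwc : Filter.Tendsto (fun p => N p - η) (nhds (0, 0)) (nhds 0) := by
    have := (hNc.tendsto (0, 0)).sub_const η
    rwa [hN0, sub_self] at this
  have hhc : Filter.Tendsto (fun p => σhat (N p - η, 0, 0) - σ) (nhds (0, 0)) (nhds 0) := by
    have h1 : Filter.Tendsto (fun w => σhat (w, 0, 0) - σ) (nhds 0) (nhds 0) := by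
      have h2 : ContinuousAt (fun w => σhat (w, 0, 0) - σ) 0 := by
        refine ContinuousAt.sub ?_ continuousAt_const
        exact (hσat 0 hU0).continuousAt.comp_of_eq (f := fun w : Euc 3 => (w, (0 : ℝ), (0 : ℝ)))
          (by fun_prop) rfl
      simpa [ContinuousAt, hσ0] using h2
    exact h1.comp hwc
  have hsmall : ∀ᶠ p in nhds ((0 : ℝ), (0 : ℝ)),
      ⟪σhat (N p - η, 0, 0) - σ, σhat (N p - η, 0, 0) - σ⟫ *
        (⟪N p, cross3 ν σ⟫ ^ 2 + (r - (⟪N p, σ⟫ - s * ⟪N p, ν⟫)) ^ 2) <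
      4 * r * ⟪N p, cross3 ν σ⟫ ^ 2 := by
    have hN' := hNc.tendsto (0, 0)
    rw [hN0] at hN'
    have hl := (hhc.inner hhc (𝕜 := ℝ)).mul
      (((hN'.inner (tendsto_const_nhds (x := cross3 ν σ)) (𝕜 := ℝ)).pow 2).add
        ((tendsto_const_nhds (x := r)).sub ((hN'.inner (tendsto_const_nhds (x := σ)) (𝕜 := ℝ)).sub
          ((tendsto_const_nhds (x := s)).mul
            (hN'.inner (tendsto_const_nhds (x := ν)) (𝕜 := ℝ)))) |>.pow 2))
    have hR := ((hN'.inner (tendsto_const_nhds (x := cross3 ν σ)) (𝕜 := ℝ)).pow 2).const_mul (4 * r)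
    refine hl.eventually_lt hR ?_
    rw [inner_zero_left, zero_mul]
    positivity
  have hev : ∀ᶠ p in nhds ((0 : ℝ), (0 : ℝ)), p.1 ∈ Icc (0 : ℝ) 1 → p.2 ∈ Icc (0 : ℝ) 1 →
      N p - η ∈ U ∧ σhat (N p - η, 0, 0) = σ := by
    filter_upwards [hsmall, hwc.eventually (hU.mem_nhds hU0)] with p hp hpU h1 h2
    refine ⟨hpU, ?_⟩
    obtain ⟨hNN, -, -⟩ := hN p h1 h2
    obtain ⟨g1, g2, g3, -⟩ := hprop _ hpU 0 h0 0 h0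
    refine sub_eq_zero.1 (eq_of_inner_constraints hνν hσσ hs.symm hr ?_ ?_ ?_ hp)
    · rw [inner_sub_left, hσhat_ν _ hpU 0 h0 0 h0, real_inner_comm, hs]; ring
    · rw [add_sub_cancel, hσσ, real_inner_self_eq_norm_sq, g2.1.1]
    · have : N p + (σhat (N p - η, 0, 0) - σ) = ηhat (N p - η, 0, 0) := by
        rw [hy, zero_smul] at g3
        rw [eq_add_of_sub_eq g3.symm]
        abel
      rw [this, hNN, real_inner_self_eq_norm_sq, g1.1]
  obtain ⟨κ, hκ, hball⟩ := Metric.eventually_nhds_iff.1 hev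
  obtain ⟨κ', hκ', hκκ, hκ1⟩ : ∃ κ' : ℝ, 0 < κ' ∧ κ' < κ ∧ κ' < 1 :=
    ⟨min κ 1 / 2, by positivity, by linarith [min_le_left κ 1, lt_min hκ one_pos],
      by linarith [min_le_right κ 1, lt_min hκ one_pos]⟩
  set X₀ := ⟪η, σ⟫ - s * ⟪η, ν⟫ with hX₀
  obtain ⟨ρ, hρ, hX⟩ : ∃ ρ ∈ Icc 0 κ', ((1 - ρ) * X₀) ^ 2 ≠ r ^ 2 := by
    by_cases h : X₀ ^ 2 = r ^ 2
    · refine ⟨κ', ⟨hκ'.le, le_rfl⟩, fun h' => ?_⟩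
      have : r ^ 2 * (κ' * (2 - κ')) = 0 := by linear_combination (1 - κ') ^ 2 * h - h'
      have h2 : 0 < 2 - κ' := by linarith
      have : 0 < r ^ 2 * (κ' * (2 - κ')) := by positivity
      linarith
    · exact ⟨0, ⟨le_rfl, hκ'.le⟩, by simpa using h⟩
  set X := (1 - ρ) * X₀
  obtain ⟨c₁, c₂, c₃, hcub⟩ := cubic_relation hνν hσσ hs.symm hr hr0.ne' (b σ) (fderiv ℝ b σ)
    (fderiv ℝ (fderiv ℝ b) σ) hQ X
  have hzero : ∀ τ ∈ Ioo 0 κ', b σ * fderiv ℝ b σ (cross3 ν σ) *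
      (k0 ^ 2 / 4 * (1 - X ^ 2 / r ^ 2) * (X - r) : ℝ) +
        c₁ * ((1 - τ) * ⟪η, cross3 ν σ⟫ : ℝ) + c₂ * ((1 - τ) * ⟪η, cross3 ν σ⟫ : ℝ) ^ 2 +
        c₃ * ((1 - τ) * ⟪η, cross3 ν σ⟫ : ℝ) ^ 3 = 0 := by
    intro τ hτ
    have hρ1 : ρ ∈ Icc (0 : ℝ) 1 := ⟨hρ.1, by linarith [hρ.2]⟩
    have hτ1 : τ ∈ Icc (0 : ℝ) 1 := ⟨hτ.1.le, by linarith [hτ.2]⟩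
    have hdist : dist (ρ, τ) ((0 : ℝ), (0 : ℝ)) < κ := by
      rw [Prod.dist_eq, Real.dist_eq, Real.dist_eq, sub_zero, sub_zero, abs_of_nonneg hρ.1,
        abs_of_pos hτ.1]
      exact max_lt (by linarith [hρ.2]) (by linarith [hτ.2])
    obtain ⟨hw, hσw⟩ := hball hdist hρ1 hτ1
    obtain ⟨hNN, hNX, hND⟩ := hN (ρ, τ) hρ1 hτ1
    set w := N (ρ, τ) - η with hw_def
    have hIoo : ∀ᶠ p in nhds ((0 : ℝ), (0 : ℝ)), p ∈ Ioo a c ×ˢ Ioo a c :=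
      (isOpen_Ioo.prod isOpen_Ioo).mem_nhds ⟨h0, h0⟩
    have hG : ContDiffAt ℝ 2 (fun p : ℝ × ℝ => σhat (w, p)) (0, 0) :=
      (hσat w hw).comp (f := fun p : ℝ × ℝ => (w, p)) (0, 0) (contDiffAt_const.prodMk contDiffAt_id)
    obtain ⟨u, v, W, r1, r2, r3, r4, r5, r6, r7, r8, r9, r10⟩ :=
      derivative_relations (η := N (ρ, τ)) (ν := ν) (k := k0 ^ 2) (s := s) hbσ hG hσw
        (hIoo.mono fun p hp => by
          rw [real_inner_self_eq_norm_sq, (hprop w hw _ hp.1 _ hp.2).2.1.1.1])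
        (hIoo.mono fun p hp => by
          have h := hprop w hw _ hp.1 _ hp.2
          have e : σhat (w, p) + (N (ρ, τ) - σ) + p.1 • ν = ηhat (w, p) := by
            have := h.2.2.1
            rw [hy, hw_def] at this
            rw [eq_add_of_sub_eq this.symm]
            abel
          rw [e, real_inner_self_eq_norm_sq, h.1.1])
        (hIoo.mono fun p hp => hσhat_ν w hw _ hp.1 _ hp.2)
        (hIoo.mono fun p hp => by
          have := hdet w hw _ hp.1 _ hp.2
          rwa [hσw] at this)
    have := hcub (N (ρ, τ)) u v W hNN hNX r1 r2 r3 r4 r5 r6 r7 r8 r9 r10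
    rwa [hND] at this
  have hinf : ((fun τ : ℝ => (1 - τ) * ⟪η, cross3 ν σ⟫) '' Ioo 0 κ').Infinite := by
    refine (Ioo_infinite hκ').image fun x _ y _ h => ?_
    have := mul_right_cancel₀ hD h
    linarith
  have hc0 := cubic_constant_coeff_eq_zero hinf (by rintro _ ⟨τ, hτ, rfl⟩; exact hzero τ hτ)
  have hne : k0 ^ 2 / 4 * (1 - X ^ 2 / r ^ 2) * (X - r) ≠ 0 := by
    refine mul_ne_zero (mul_ne_zero (by positivity) ?_) ?_
    · rw [sub_ne_zero, ne_comm, Ne, div_eq_one_iff_eq (by positivity)]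
      exact hX
    · exact sub_ne_zero.2 fun h => hX (by rw [h])
  have := (mul_eq_zero.1 hc0).resolve_right (Complex.ofReal_ne_zero.2 hne)
  exact (mul_eq_zero.1 this).resolve_left hb0
end
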